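/- arXiv:1605.01557 — 2 statements merged into one kernel-verified Lean document; each statement's English description precedes it below -/
import Mathlib

section
/- (Theorem 1, regimes 2 and 3: Jain throughput–fairness tradeoff above the critical throughput.) Let n ≥ 2, t ∈ {2,…,n}, and θ ∈ [θ_t, θ_{t−1}). For p_s ∈ (0, 1/t], set p_l(p_s) = (1 − p_s)/(t−1). Then there is a unique p_s* ∈ (0, 1/t] satisfying p_s*·(1 − p_l(p_s*))^{t−1} + (1 − p_s*)²·(1 − p_l(p_s*))^{t−2} = θ. Let p* ∈ [0,1)^n be the control with one component equal to p_s*, t−1 components equal to p_l(p_s*), and the remaining n−t components equal to 0. Then T(x(p*)) = θ, and F_J(x(p*)) ≥ F_J(x(p)) for every p ∈ [0,1)^n with T(x(p)) = θ. Moreover, if θ = θ_t then p_s* = 1/t (so p* has t components equal to 1/t) and F_J(x(p*)) = t/n. -/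
open scoped BigOperators

/-- The worst-case service rate of user `i` under control `p`. -/
noncomputable def rate {n : ℕ} (p : Fin n → ℝ) (i : Fin n) : ℝ :=
  p i * ∏ j ∈ Finset.univ.erase i, (1 - p j)

/-- The throughput of the rate vector of control `p`. -/
noncomputable def tput {n : ℕ} (p : Fin n → ℝ) : ℝ := ∑ i, rate p i

/-- Jain's fairness of a vector `x ∈ ℝ^n`. -/
noncomputable def jain {n : ℕ} (x : Fin n → ℝ) : ℝ :=
  (∑ i, x i) ^ 2 / ((n : ℝ) * ∑ i, (x i) ^ 2)

/-- The critical throughput `θ_t = (1 - 1/t)^(t-1)`. -/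
noncomputable def crit (t : ℕ) : ℝ := (1 - 1 / (t : ℝ)) ^ (t - 1)

/-- The control with one component `p_s`, `t-1` components `(1-p_s)/(t-1)`, and
the remaining `n-t` components `0`. -/
noncomputable def pstar (n t : ℕ) (ps : ℝ) : Fin n → ℝ := fun i =>
  if (i : ℕ) = 0 then ps else if (i : ℕ) < t then (1 - ps) / ((t : ℝ) - 1) else 0

/-- The throughput of the control with one component `x` and `m` components `(1 - x) / m`. -/
noncomputable def simplexTput (m : ℕ) (x : ℝ) : ℝ :=
  x * (1 - (1 - x) / (m : ℝ)) ^ m + (1 - x) ^ 2 * (1 - (1 - x) / (m : ℝ)) ^ (m - 1)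

lemma simplexTput_zero (m : ℕ) : simplexTput m 0 = crit m := by
  simp [simplexTput, crit]

lemma simplexTput_one_div {m : ℕ} (hm : 1 ≤ m) :
    simplexTput m (1 / ((m : ℝ) + 1)) = crit (m + 1) := by
  have h0 : (0 : ℝ) < m := by exact_mod_cast hm
  have h1 : (1 - (1 - 1 / ((m : ℝ) + 1)) / (m : ℝ)) = 1 - 1 / ((m : ℝ) + 1) := by
    field_simp
    ring
  simp only [simplexTput, crit, h1, Nat.add_sub_cancel, Nat.cast_add, Nat.cast_one]
  obtain ⟨k, rfl⟩ : ∃ k, m = k + 1 := ⟨m - 1, by omega⟩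
  rw [Nat.add_sub_cancel]
  ring

lemma continuous_simplexTput (m : ℕ) : Continuous (simplexTput m) := by
  unfold simplexTput
  fun_prop

lemma simplexTput_strictAntiOn {m : ℕ} (hm : 1 ≤ m) :
    StrictAntiOn (simplexTput m) (Set.Icc 0 (1 / ((m : ℝ) + 1))) := by
  obtain rfl | ⟨k, rfl⟩ : m = 1 ∨ ∃ k, m = k + 2 := by
    rcases Nat.lt_or_ge m 2 with h | h
    · left; omega
    · right; exact ⟨m - 2, by omega⟩
  · intro x hx y hy hxy
    have hy2 := hy.2
    norm_num at hy2
    simp only [simplexTput]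
    norm_num
    nlinarith
  · refine strictAntiOn_of_deriv_neg (convex_Icc _ _)
      (continuous_simplexTput _).continuousOn fun x hx => ?_
    rw [interior_Icc] at hx
    obtain ⟨hx0, hx1⟩ := hx
    have hk : (0 : ℝ) ≤ k := k.cast_nonneg
    set M : ℝ := ((k + 2 : ℕ) : ℝ) with hM
    have hM2 : (2 : ℝ) ≤ M := by rw [hM]; push_cast; linarith
    have hMk : (k : ℝ) = M - 2 := by rw [hM]; push_cast; ring
    have hu : HasDerivAt (fun x : ℝ => 1 - (1 - x) / M) (1 / M) x := by
      have := (((hasDerivAt_id x).const_sub 1).div_const M).const_sub 1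
      refine this.congr_deriv ?_
      ring
    have hd := ((hasDerivAt_id x).mul (hu.pow (k + 2))).add
      ((((hasDerivAt_id x).const_sub 1).pow 2).mul (hu.pow (k + 1)))
    have hd' : HasDerivAt (simplexTput (k + 2)) _ x := hd
    rw [hd'.deriv]
    have hlt : (M + 1) * x < 1 := by
      rw [lt_div_iff₀ (by linarith)] at hx1
      linarith
    have hu0 : 0 < 1 - (1 - x) / M := by
      rw [sub_pos, div_lt_one (by linarith)]
      linarith
    have hx' : x = 1 - M * (1 - (1 - (1 - x) / M)) := by field_simp; ring
    simp only [id, Nat.add_sub_cancel, Pi.pow_apply, ← hM]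
    generalize 1 - (1 - x) / M = u at hu0 hx' ⊢
    push_cast
    rw [hMk]
    have e : 1 * u ^ (k + 2) + x * (M * u ^ (k + 1) * (1 / M)) +
        (2 * (1 - x) ^ 1 * -1 * u ^ (k + 1) +
          (1 - x) ^ 2 * ((M - 2 + 1) * u ^ k * (1 / M))) =
        u ^ k * (((M + 1) * u - M) * ((M + 1) * u - (M - 1))) := by
      rw [hx']
      field_simp
      ring
    rw [e]
    have h1 : (M + 1) * u - M < 0 := by
      by_contra! h
      nlinarith
    have h2 : 0 < (M + 1) * u - (M - 1) := by nlinarith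
    exact mul_neg_of_pos_of_neg (pow_pos hu0 k) (mul_neg_of_neg_of_pos h1 h2)

lemma exists_lower_triple {a b c : ℝ} (ha : 0 < a) (hab : a ≤ b) (hbc : b < c) :
    ∃ a' b' c' : ℝ, 0 ≤ a' ∧ 0 ≤ b' ∧ 0 ≤ c' ∧ a' + b' + c' = a + b + c ∧
      a' ^ 2 + b' ^ 2 + c' ^ 2 = a ^ 2 + b ^ 2 + c ^ 2 ∧
      (1 + a') * (1 + b') * (1 + c') < (1 + a) * (1 + b) * (1 + c) := by
  have hc : 0 < c := by linarith
  obtain ⟨d, hd0, hda, hd⟩ : ∃ d : ℝ, 0 < d ∧ d ≤ a ∧ d * (7 * c) ≤ (c - b) ^ 2 := by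
    refine ⟨min a ((c - b) ^ 2 / (7 * c)), lt_min ha ?_, min_le_left _ _, ?_⟩
    · have : 0 < c - b := by linarith
      positivity
    · rw [← le_div_iff₀ (by positivity)]
      exact min_le_right _ _
  set D : ℝ := (c - b) ^ 2 - d * (2 * (b - a) + 2 * (c - a)) - 3 * d ^ 2 with hD
  have hD0 : 0 ≤ D := by nlinarith
  have hsq : √D ^ 2 = D := Real.sq_sqrt hD0
  have hle : √D ≤ b + c + d := by
    apply Real.sqrt_le_iff.2
    constructor
    · linarith
    · nlinarith [mul_pos hd0 ha, mul_pos ha hc, sq_nonneg d,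
        mul_nonneg hd0.le (sub_nonneg.2 hda), mul_nonneg hd0.le (sub_nonneg.2 hab),
        mul_pos (ha.trans_le hab) hc]
  have h0 := Real.sqrt_nonneg D
  generalize √D = r at *
  have hr : r ^ 2 = (c - b) ^ 2 - d * (2 * (b - a) + 2 * (c - a)) - 3 * d ^ 2 := hsq
  refine ⟨a - d, (b + c + d - r) / 2, (b + c + d + r) / 2, by linarith, by linarith,
    by linarith, by ring, by linear_combination hr / 2, ?_⟩
  have e : (1 + a) * (1 + b) * (1 + c) -
      (1 + (a - d)) * (1 + (b + c + d - r) / 2) * (1 + (b + c + d + r) / 2) =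
      d * (d + (b - a)) * (d + (c - a)) := by
    linear_combination (1 + a - d) / 4 * hr
  have : 0 < d * (d + (b - a)) * (d + (c - a)) := by
    have h1 : 0 < d + (b - a) := by linarith
    have h2 : 0 < d + (c - a) := by linarith
    positivity
  linarith

lemma prod_eq_mul_three {ι M : Type*} [Fintype ι] [DecidableEq ι] [CommMonoid M] (f : ι → M)
    {i j k : ι} (hij : i ≠ j) (hik : i ≠ k) (hjk : j ≠ k) :
    ∏ l, f l = f i * f j * f k * ∏ l ∈ ({i, j, k} : Finset ι)ᶜ, f l := by
  rw [← Finset.prod_mul_prod_compl {i, j, k}, Finset.prod_insert (by simp [hij, hik]),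
    Finset.prod_pair hjk]
  simp only [mul_assoc]

lemma sum_eq_add_three {ι M : Type*} [Fintype ι] [DecidableEq ι] [AddCommMonoid M] (f : ι → M)
    {i j k : ι} (hij : i ≠ j) (hik : i ≠ k) (hjk : j ≠ k) :
    ∑ l, f l = f i + f j + f k + ∑ l ∈ ({i, j, k} : Finset ι)ᶜ, f l := by
  rw [← Finset.sum_add_sum_compl {i, j, k}, Finset.sum_insert (by simp [hij, hik]),
    Finset.sum_pair hjk]
  simp only [add_assoc]

/-- Among nonnegative vectors with given sum and sum of squares, `∏ (1 + o i)` is minimised by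
a vector whose positive entries, the smallest one excepted, are all equal. -/
lemma exists_minimal_odds {ι : Type*} [Fintype ι] [DecidableEq ι] (o : ι → ℝ)
    (ho : ∀ i, 0 ≤ o i) :
    ∃ o' : ι → ℝ, (∀ i, 0 ≤ o' i) ∧ ∑ i, o' i = ∑ i, o i ∧ ∑ i, o' i ^ 2 = ∑ i, o i ^ 2 ∧
      ∏ i, (1 + o' i) ≤ ∏ i, (1 + o i) ∧
      ∀ i j k, i ≠ j → i ≠ k → 0 < o' i → o' i ≤ o' j → o' i ≤ o' k → o' j = o' k := by
  set K : Set (ι → ℝ) := {v | (∀ i, 0 ≤ v i) ∧ ∑ i, v i = ∑ i, o i ∧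
    ∑ i, v i ^ 2 = ∑ i, o i ^ 2} with hK
  have hclosed : IsClosed K := by
    have h1 : IsClosed {v : ι → ℝ | ∀ i, 0 ≤ v i} := by
      simp only [Set.ofPred_forall]
      exact isClosed_iInter fun i => isClosed_le continuous_const (continuous_apply i)
    have h2 : IsClosed {v : ι → ℝ | ∑ i, v i = ∑ i, o i} :=
      isClosed_eq (by fun_prop) continuous_const
    have h3 : IsClosed {v : ι → ℝ | ∑ i, v i ^ 2 = ∑ i, o i ^ 2} :=
      isClosed_eq (by fun_prop) continuous_const
    exact h1.inter (h2.inter h3)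
  have hcompact : IsCompact K := by
    refine (isCompact_Icc (a := (0 : ι → ℝ)) (b := fun _ => ∑ i, o i)).of_isClosed_subset
      hclosed fun v hv => ⟨fun i => hv.1 i, fun i => ?_⟩
    change v i ≤ ∑ i, o i
    rw [← hv.2.1]
    exact Finset.single_le_sum (fun j _ => hv.1 j) (Finset.mem_univ i)
  obtain ⟨v, ⟨hv0, hv1, hv2⟩, hmin⟩ := hcompact.exists_isMinOn ⟨o, ho, rfl, rfl⟩
    (f := fun v : ι → ℝ => ∏ i, (1 + v i)) (by fun_prop)
  have key : ∀ i j k, i ≠ j → i ≠ k → 0 < v i → v i ≤ v j → ¬ v j < v k := by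
    intro i j k hij hik hi hle hlt
    have hjk : j ≠ k := by rintro rfl; exact lt_irrefl _ hlt
    obtain ⟨a, b, c, ha, hb, hc, h1, h2, h3⟩ := exists_lower_triple hi hle hlt
    set w : ι → ℝ := fun l => if l = i then a else if l = j then b else if l = k then c else v l
      with hw
    have wi : w i = a := by simp [hw]
    have wj : w j = b := by simp [hw, hij.symm]
    have wk : w k = c := by simp [hw, hik.symm, hjk.symm]
    have wl : ∀ l ∈ ({i, j, k} : Finset ι)ᶜ, w l = v l := by
      intro l hl
      simp only [Finset.mem_compl, Finset.mem_insert, Finset.mem_singleton, not_or] at hl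
      simp [hw, hl]
    have hmem : w ∈ K := by
      refine ⟨fun l => ?_, ?_, ?_⟩
      · simp only [hw]
        split_ifs <;> first | assumption | exact hv0 l
      · rw [← hv1, sum_eq_add_three w hij hik hjk, sum_eq_add_three v hij hik hjk,
          Finset.sum_congr rfl wl, wi, wj, wk, h1]
      · rw [← hv2, sum_eq_add_three _ hij hik hjk, sum_eq_add_three (fun l => v l ^ 2) hij hik hjk,
          Finset.sum_congr rfl fun l hl => by rw [wl l hl], wi, wj, wk, h2]
    have hle' : ∏ l, (1 + v l) ≤ ∏ l, (1 + w l) := hmin hmem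
    rw [prod_eq_mul_three _ hij hik hjk, prod_eq_mul_three (fun l => 1 + w l) hij hik hjk,
      Finset.prod_congr rfl fun l hl => congrArg (1 + ·) (wl l hl), wi, wj, wk] at hle'
    have hpos : 0 < ∏ l ∈ ({i, j, k} : Finset ι)ᶜ, (1 + v l) :=
      Finset.prod_pos fun l _ => by linarith [hv0 l]
    exact absurd (mul_lt_mul_of_pos_right h3 hpos) (not_lt.2 hle')
  refine ⟨v, hv0, hv1, hv2, hmin ⟨ho, rfl, rfl⟩, fun i j k hij hik hi hj hk => ?_⟩
  exact le_antisymm (not_lt.1 (key i k j hik hij hi hk)) (not_lt.1 (key i j k hij hik hi hj))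

/-- The odds `x / (1 - x)` of a probability `x`. -/
noncomputable def odds (x : ℝ) : ℝ := x / (1 - x)

lemma odds_nonneg {x : ℝ} (h0 : 0 ≤ x) (h1 : x < 1) : 0 ≤ odds x :=
  div_nonneg h0 (sub_pos.2 h1).le

lemma odds_pos {x : ℝ} (h0 : 0 < x) (h1 : x < 1) : 0 < odds x :=
  div_pos h0 (sub_pos.2 h1)

lemma one_add_odds {x : ℝ} (h : x < 1) : 1 + odds x = (1 - x)⁻¹ := by
  have : 1 - x ≠ 0 := (sub_pos.2 h).ne'
  unfold odds
  field_simp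
  ring

lemma odds_le_odds {x y : ℝ} (hxy : x ≤ y) (hy : y < 1) : odds x ≤ odds y := by
  unfold odds
  rw [div_le_div_iff₀ (by linarith) (by linarith)]
  linarith

lemma rate_eq_odds {n : ℕ} {p : Fin n → ℝ} (hp : ∀ i, p i < 1) (i : Fin n) :
    rate p i = odds (p i) * (∏ j, (1 + odds (p j)))⁻¹ := by
  have h : (∏ j, (1 + odds (p j)))⁻¹ = ∏ j, (1 - p j) := by
    rw [← Finset.prod_inv_distrib]
    exact Finset.prod_congr rfl fun j _ => by rw [one_add_odds (hp j), inv_inv]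
  have hi : 1 - p i ≠ 0 := (sub_pos.2 (hp i)).ne'
  rw [h, ← Finset.mul_prod_erase _ _ (Finset.mem_univ i), rate, odds]
  field_simp

lemma tput_eq_odds {n : ℕ} {p : Fin n → ℝ} (hp : ∀ i, p i < 1) :
    tput p = (∑ i, odds (p i)) / ∏ j, (1 + odds (p j)) := by
  simp only [tput, rate_eq_odds hp, ← Finset.sum_mul, div_eq_mul_inv]

lemma jain_mul {n : ℕ} (x : Fin n → ℝ) {c : ℝ} (hc : c ≠ 0) :
    jain (fun i => x i * c) = jain x := by
  simp only [jain, mul_pow, ← Finset.sum_mul]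
  rw [← mul_assoc, mul_div_mul_right _ _ (pow_ne_zero 2 hc)]

lemma jain_rate_eq_odds {n : ℕ} {p : Fin n → ℝ} (hp : ∀ i, p i ∈ Set.Ico (0 : ℝ) 1) :
    jain (fun i => rate p i) = jain fun i => odds (p i) := by
  simp only [rate_eq_odds fun i => (hp i).2]
  refine jain_mul _ (inv_ne_zero (Finset.prod_pos fun j _ => ?_).ne')
  linarith [odds_nonneg (hp j).1 (hp j).2]

lemma prod_of_two_values {ι R : Type*} [Fintype ι] [DecidableEq ι] [CommMonoid R] {o : ι → ℝ}
    {A : Finset ι} {i : ι} {s L : ℝ} (hi : i ∈ A) (hs : o i = s)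
    (hL : ∀ j ∈ A, j ≠ i → o j = L) (h0 : ∀ j ∉ A, o j = 0) {g : ℝ → R} (hg : g 0 = 1) :
    ∏ j, g (o j) = g s * g L ^ (A.card - 1) := by
  rw [← Finset.prod_subset (Finset.subset_univ A) fun j _ hj => by rw [h0 j hj, hg],
    ← Finset.mul_prod_erase A _ hi, hs, ← Finset.card_erase_of_mem hi]
  congr 1
  refine Finset.prod_eq_pow_card fun j hj => ?_
  rw [hL j (Finset.mem_of_mem_erase hj) (Finset.ne_of_mem_erase hj)]

lemma sum_of_two_values {ι R : Type*} [Fintype ι] [DecidableEq ι] [AddCommMonoid R] {o : ι → ℝ}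
    {A : Finset ι} {i : ι} {s L : ℝ} (hi : i ∈ A) (hs : o i = s)
    (hL : ∀ j ∈ A, j ≠ i → o j = L) (h0 : ∀ j ∉ A, o j = 0) {g : ℝ → R} (hg : g 0 = 0) :
    ∑ j, g (o j) = g s + (A.card - 1) • g L :=
  prod_of_two_values (R := Multiplicative R) (g := fun x => Multiplicative.ofAdd (g x))
    hi hs hL h0 hg

lemma simplex_bounds {m : ℕ} (hm : 1 ≤ m) {x : ℝ} (hx : x ∈ Set.Ioc (0 : ℝ) (1 / ((m : ℝ) + 1))) :
    x < 1 ∧ 0 < (1 - x) / (m : ℝ) ∧ (1 - x) / (m : ℝ) < 1 ∧ x ≤ (1 - x) / (m : ℝ) := by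
  have h1 : (1 : ℝ) ≤ m := by exact_mod_cast hm
  obtain ⟨h0, h⟩ := hx
  rw [le_div_iff₀ (by linarith)] at h
  have hx1 : x < 1 := by nlinarith
  refine ⟨hx1, div_pos (by linarith) (by linarith), ?_, ?_⟩
  · rw [div_lt_one (by linarith)]
    linarith
  · rw [le_div_iff₀ (by linarith)]
    linarith

lemma simplexTput_eq_odds {m : ℕ} (hm : 1 ≤ m) {x : ℝ}
    (hx : x ∈ Set.Ioc (0 : ℝ) (1 / ((m : ℝ) + 1))) :
    simplexTput m x = (odds x + m * odds ((1 - x) / m)) /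
      ((1 + odds x) * (1 + odds ((1 - x) / m)) ^ m) := by
  obtain ⟨h1, -, h2, -⟩ := simplex_bounds hm hx
  have h0 : (m : ℝ) ≠ 0 := by positivity
  rw [one_add_odds h1, one_add_odds h2, simplexTput, odds, odds]
  have hy : 1 - x = m * ((1 - x) / m) := by field_simp
  have hx' : 1 - x ≠ 0 := by linarith
  have hy' : 1 - (1 - x) / m ≠ 0 := by linarith
  obtain ⟨k, rfl⟩ : ∃ k, m = k + 1 := ⟨m - 1, by omega⟩
  rw [Nat.add_sub_cancel, inv_pow, ← mul_inv, div_inv_eq_mul]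
  generalize (1 - x) / ((k + 1 : ℕ) : ℝ) = y at *
  rw [add_mul, div_mul_eq_mul_div, mul_div_assoc', ← hy, pow_succ]
  field_simp

lemma one_add_mul_odds_ge {x c : ℝ} (h0 : 0 ≤ x) (h1 : x < 1) (hc : 0 < c) :
    (1 + odds x) * c ^ x ≤ 1 + c * odds x := by
  have h := Real.geom_mean_le_arith_mean2_weighted (sub_pos.2 h1).le h0 zero_le_one hc.le
    (by ring)
  rw [Real.one_rpow, one_mul, mul_one] at h
  have e : 1 + c * odds x = (1 + odds x) * (1 - x + x * c) := by
    have : 1 - x ≠ 0 := by linarith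
    unfold odds
    field_simp
    ring
  rw [e]
  exact mul_le_mul_of_nonneg_left h (by linarith [odds_nonneg h0 h1])

/-- Scaling odds can only raise the throughput when it brings the control to the simplex. -/
lemma exists_simplex_scaling {m : ℕ} (hm : 1 ≤ m) {s L : ℝ} (hs : 0 < s) (hL : s ≤ L) :
    ∃ x ∈ Set.Ioc (0 : ℝ) (1 / ((m : ℝ) + 1)), ∃ c : ℝ, 0 < c ∧ s = c * odds x ∧
      L = c * odds ((1 - x) / m) ∧
      (s + m * L) / ((1 + s) * (1 + L) ^ m) ≤ simplexTput m x := by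
  have hm0 : (0 : ℝ) < m := by exact_mod_cast hm
  obtain ⟨x, hx, hxe⟩ : ∃ x ∈ Set.Ioc (0 : ℝ) (1 / ((m : ℝ) + 1)),
      s * ((1 - x) / m) * (1 - x) - L * x * (1 - (1 - x) / m) = 0 := by
    set h : ℝ → ℝ := fun x => s * ((1 - x) / m) * (1 - x) - L * x * (1 - (1 - x) / m) with hh
    have hc : ContinuousOn h (Set.Icc 0 (1 / ((m : ℝ) + 1))) := by
      rw [hh]; fun_prop
    have hpos : 0 < h 0 := by simp only [hh]; norm_num; positivity
    have hend : h (1 / ((m : ℝ) + 1)) ≤ 0 := by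
      have : h (1 / ((m : ℝ) + 1)) = (s - L) * (m / ((m : ℝ) + 1) ^ 2) := by
        simp only [hh]
        field_simp
        ring
      rw [this]
      exact mul_nonpos_of_nonpos_of_nonneg (by linarith) (by positivity)
    obtain ⟨x, hx, hx0⟩ := intermediate_value_Icc' (by positivity) hc ⟨hend, hpos.le⟩
    refine ⟨x, ⟨lt_of_le_of_ne hx.1 ?_, hx.2⟩, hx0⟩
    rintro rfl
    exact hpos.ne' hx0
  obtain ⟨h1, hy0, hy1, hxy⟩ := simplex_bounds hm hx
  have hsum : x + (1 - x) / m * m = 1 := by field_simp; ring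
  refine ⟨x, hx, ?_⟩
  rw [simplexTput_eq_odds hm hx]
  generalize (1 - x) / (m : ℝ) = y at *
  have ha := odds_pos hx.1 h1
  have hb := odds_pos hy0 hy1
  have hc : 0 < s / odds x := div_pos hs ha
  have hsc : s = s / odds x * odds x := by field_simp
  have hLc : L = s / odds x * odds y := by
    have : x ≠ 0 := hx.1.ne'
    have : 1 - x ≠ 0 := by linarith
    have : 1 - y ≠ 0 := by linarith
    unfold odds
    field_simp
    linarith
  refine ⟨s / odds x, hc, hsc, hLc, ?_⟩
  generalize s / odds x = c at *
  subst hsc hLc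
  have g1 := one_add_mul_odds_ge hx.1.le h1 hc
  have g2 := one_add_mul_odds_ge hy0.le hy1 hc
  have g3 : (1 + odds x) * (1 + odds y) ^ m * c ≤ (1 + c * odds x) * (1 + c * odds y) ^ m := by
    calc (1 + odds x) * (1 + odds y) ^ m * c
        = ((1 + odds x) * c ^ x) * ((1 + odds y) * c ^ y) ^ m := by
          rw [mul_pow, ← Real.rpow_mul_natCast hc.le]
          have : c = c ^ x * c ^ (y * (m : ℝ)) := by
            rw [← Real.rpow_add hc, hsum, Real.rpow_one]
          nth_rewrite 1 [this]
          ring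
      _ ≤ _ := by gcongr
  rw [div_le_div_iff₀ (by positivity) (by positivity)]
  have : 0 ≤ odds x + m * odds y := by positivity
  nlinarith [mul_le_mul_of_nonneg_left g3 this]

lemma concentration_le_of_ratio_le {m a A b B : ℝ} (hm : 1 ≤ m) (ha : 0 ≤ a) (hA : 0 < A)
    (hB : 0 < B) (h : a * B ≤ b * A) (hbB : b ≤ B) :
    (b ^ 2 + m * B ^ 2) * (a + m * A) ^ 2 ≤ (a ^ 2 + m * A ^ 2) * (b + m * B) ^ 2 := by
  have hb : 0 ≤ b := by
    by_contra! hb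
    nlinarith [mul_nonneg ha hB.le, mul_neg_of_neg_of_pos hb hA]
  have haA : a ≤ A := by
    have : a * B ≤ A * B := by nlinarith
    exact le_of_mul_le_mul_right this hB
  have e : (a ^ 2 + m * A ^ 2) * (b + m * B) ^ 2 - (b ^ 2 + m * B ^ 2) * (a + m * A) ^ 2 =
      m * (b * A - a * B) *
        (2 * (A * B - a * b) + (m - 1) * (A * (B - b) + B * (A - a))) := by ring
  have h1 : a * b ≤ A * B := mul_le_mul haA hbB hb hA.le
  have h2 : 0 ≤ A * (B - b) + B * (A - a) :=
    add_nonneg (mul_nonneg hA.le (by linarith)) (mul_nonneg hB.le (by linarith))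
  have : 0 ≤ m * (b * A - a * B) *
        (2 * (A * B - a * b) + (m - 1) * (A * (B - b) + B * (A - a))) :=
    mul_nonneg (mul_nonneg (by linarith) (by linarith))
      (add_nonneg (by linarith) (mul_nonneg (by linarith) h2))
  linarith

lemma crit_antitone {a b : ℕ} (ha : 1 ≤ a) (hab : a ≤ b) : crit b ≤ crit a := by
  induction b, hab using Nat.le_induction with
  | base => exact le_rfl
  | succ k hk ih =>
    have hk1 : 1 ≤ k := ha.trans hk
    refine le_trans ?_ ih
    rw [← simplexTput_one_div hk1, ← simplexTput_zero]
    exact (simplexTput_strictAntiOn hk1).antitoneOn ⟨le_rfl, by positivity⟩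
      ⟨by positivity, le_rfl⟩ (by positivity)

/-- Nonnegative odds whose throughput is that of a simplex control `x` are at least as
concentrated as the odds of `x`. -/
lemma simplex_concentration_le {ι : Type*} [Fintype ι] {m : ℕ} (hm : 1 ≤ m) {x : ℝ}
    (hx : x ∈ Set.Ioc (0 : ℝ) (1 / ((m : ℝ) + 1))) {o : ι → ℝ} (ho : ∀ i, 0 ≤ o i)
    (hT : (∑ i, o i) / ∏ i, (1 + o i) = simplexTput m x) :
    (odds x ^ 2 + m * odds ((1 - x) / m) ^ 2) * (∑ i, o i) ^ 2 ≤
      (∑ i, o i ^ 2) * (odds x + m * odds ((1 - x) / m)) ^ 2 := by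
  classical
  have hm1 : (1 : ℝ) ≤ m := by exact_mod_cast hm
  obtain ⟨h1, hy0, hy1, hxy⟩ := simplex_bounds hm hx
  have hb := odds_pos hx.1 h1
  have hB := odds_pos hy0 hy1
  have hbB := odds_le_odds hxy hy1
  obtain ⟨v, hv0, hv1, hv2, hv3, hv⟩ := exists_minimal_odds o ho
  have hprod : 0 < ∏ i, (1 + v i) := Finset.prod_pos fun i _ => by linarith [hv0 i]
  have hsum0 : 0 ≤ ∑ i, v i := Finset.sum_nonneg fun i _ => hv0 i
  have hTv : simplexTput m x ≤ (∑ i, v i) / ∏ i, (1 + v i) := by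
    rw [← hT, ← hv1]
    exact div_le_div_of_nonneg_left hsum0 hprod hv3
  rw [← hv1, ← hv2]
  set A : Finset ι := {i | 0 < v i} with hA
  have hA0 : ∀ j ∉ A, v j = 0 := fun j hj =>
    le_antisymm (not_lt.1 fun h => hj (by simp [hA, h])) (hv0 j)
  rcases le_or_gt A.card m with hcard | hcard
  · have c1 : (∑ i, v i) ^ 2 ≤ m * ∑ i, v i ^ 2 := by
      rw [← Finset.sum_subset (Finset.subset_univ A) fun j _ hj => hA0 j hj,
        ← Finset.sum_subset (Finset.subset_univ A) fun j _ hj => by rw [hA0 j hj]; norm_num]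
      refine sq_sum_le_card_mul_sum_sq.trans ?_
      gcongr
    have c2 : m * (odds x ^ 2 + m * odds ((1 - x) / m) ^ 2) ≤
        (odds x + m * odds ((1 - x) / m)) ^ 2 := by
      nlinarith [mul_nonneg (by linarith : (0 : ℝ) ≤ m) (mul_nonneg hb.le (sub_nonneg.2 hbB)),
        mul_pos hb hB, mul_pos hb hb, mul_pos (by linarith : (0 : ℝ) < m) (mul_pos hb hB)]
    have c3 : 0 ≤ ∑ i, v i ^ 2 := Finset.sum_nonneg fun i _ => sq_nonneg _
    have c4 : 0 ≤ odds x ^ 2 + m * odds ((1 - x) / m) ^ 2 := by positivity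
    nlinarith [mul_le_mul_of_nonneg_left c1 c4, mul_le_mul_of_nonneg_left c2 c3]
  · obtain ⟨i, hi, hmin⟩ := A.exists_min_image v (Finset.card_pos.1 (by omega))
    obtain ⟨j, hj⟩ : (A.erase i).Nonempty := by
      rw [← Finset.card_pos, Finset.card_erase_of_mem hi]
      omega
    have hipos : 0 < v i := by simpa [hA] using hi
    have hL : ∀ k ∈ A, k ≠ i → v k = v j := fun k hk hki =>
      hv i k j hki.symm (Finset.ne_of_mem_erase hj).symm hipos (hmin k hk)
        (hmin j (Finset.mem_of_mem_erase hj))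
    have hij : v i ≤ v j := hmin j (Finset.mem_of_mem_erase hj)
    have s1 := sum_of_two_values hi rfl hL hA0 (g := fun x : ℝ => x) rfl
    have s2 := sum_of_two_values hi rfl hL hA0 (g := fun x : ℝ => x ^ 2) (by norm_num)
    have s3 := prod_of_two_values hi rfl hL hA0 (g := fun x : ℝ => 1 + x) (by norm_num)
    obtain ⟨N, hN⟩ : ∃ N, A.card - 1 = N := ⟨_, rfl⟩
    have hmN : m ≤ N := by omega
    simp only [hN, nsmul_eq_mul] at s1 s2 s3
    obtain ⟨z, hz, c, hc, hzs, hzL, hzT⟩ := exists_simplex_scaling (hm.trans hmN) hipos hij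
    rw [s1, s3] at hTv
    have hle := hTv.trans hzT
    rcases hmN.eq_or_lt with rfl | hlt
    · have hzx : z ≤ x := by
        by_contra! h
        exact absurd hle (not_le.2 (simplexTput_strictAntiOn hm ⟨hx.1.le, hx.2⟩
          ⟨hz.1.le, hz.2⟩ h))
      obtain ⟨g1, gy0, gy1, -⟩ := simplex_bounds hm hz
      have k1 := odds_le_odds hzx h1
      have k2 : odds ((1 - x) / m) ≤ odds ((1 - z) / m) :=
        odds_le_odds (by gcongr) gy1
      have k3 := concentration_le_of_ratio_le hm1 (odds_pos hz.1 g1).le (odds_pos gy0 gy1) hB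
        (mul_le_mul k1 k2 hB.le hb.le) hbB
      rw [s1, s2, hzs, hzL]
      have := mul_le_mul_of_nonneg_left k3 (sq_nonneg c)
      linarith
    · exfalso
      have hN1 : 1 ≤ N := hm.trans hmN
      have e1 : simplexTput N z < crit N := by
        rw [← simplexTput_zero]
        exact simplexTput_strictAntiOn hN1 ⟨le_rfl, by positivity⟩ ⟨hz.1.le, hz.2⟩ hz.1
      have e2 : crit N ≤ crit (m + 1) := crit_antitone (by omega) hlt
      have e3 : crit (m + 1) ≤ simplexTput m x := by
        rw [← simplexTput_one_div hm]
        exact (simplexTput_strictAntiOn hm).antitoneOn ⟨hx.1.le, hx.2⟩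
          ⟨by positivity, le_rfl⟩ hx.2
      linarith

lemma jain_le_jain {n : ℕ} {x y : Fin n → ℝ} (hx : 0 < ∑ i, x i ^ 2)
    (hy : 0 < ∑ i, y i ^ 2)
    (h : (∑ i, y i ^ 2) * (∑ i, x i) ^ 2 ≤ (∑ i, x i ^ 2) * (∑ i, y i) ^ 2) :
    jain x ≤ jain y := by
  rcases n.eq_zero_or_pos with rfl | hn
  · simp at hx
  have hn' : (0 : ℝ) < n := by exact_mod_cast hn
  rw [jain, jain, div_le_div_iff₀ (by positivity) (by positivity)]
  nlinarith [mul_le_mul_of_nonneg_left h hn'.le]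

theorem jain_regimes_two_three (n t : ℕ) (hn : 2 ≤ n) (ht : 2 ≤ t) (htn : t ≤ n)
    (θ : ℝ) (hθ1 : crit t ≤ θ) (hθ2 : θ < crit (t - 1)) :
    (∃! ps : ℝ, ps ∈ Set.Ioc (0:ℝ) (1 / (t : ℝ)) ∧
      ps * (1 - (1 - ps) / ((t : ℝ) - 1)) ^ (t - 1) +
        (1 - ps) ^ 2 * (1 - (1 - ps) / ((t : ℝ) - 1)) ^ (t - 2) = θ) ∧
    ∀ ps : ℝ, ps ∈ Set.Ioc (0:ℝ) (1 / (t : ℝ)) →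
      ps * (1 - (1 - ps) / ((t : ℝ) - 1)) ^ (t - 1) +
        (1 - ps) ^ 2 * (1 - (1 - ps) / ((t : ℝ) - 1)) ^ (t - 2) = θ →
      (tput (pstar n t ps) = θ ∧
       (∀ p : Fin n → ℝ, (∀ i, p i ∈ Set.Ico (0:ℝ) 1) → tput p = θ →
         jain (fun i => rate p i) ≤ jain (fun i => rate (pstar n t ps) i)) ∧
       (θ = crit t → ps = 1 / (t : ℝ) ∧
         jain (fun i => rate (pstar n t ps) i) = (t : ℝ) / n)) := by
  obtain ⟨m, rfl⟩ : ∃ m, t = m + 1 := ⟨t - 1, by omega⟩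
  have hm : 1 ≤ m := by omega
  have hm0 : (0 : ℝ) < m := by exact_mod_cast hm
  have hcast : ((m + 1 : ℕ) : ℝ) = (m : ℝ) + 1 := by push_cast; ring
  have hF : ∀ x : ℝ, x * (1 - (1 - x) / (((m + 1 : ℕ) : ℝ) - 1)) ^ (m + 1 - 1) +
      (1 - x) ^ 2 * (1 - (1 - x) / (((m + 1 : ℕ) : ℝ) - 1)) ^ (m + 1 - 2) =
      simplexTput m x := by
    intro x
    rw [hcast, add_sub_cancel_right, simplexTput, show m + 1 - 1 = m by omega,
      show m + 1 - 2 = m - 1 by omega]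
  simp only [hF]
  rw [hcast]
  rw [Nat.add_sub_cancel] at hθ2
  have hanti := simplexTput_strictAntiOn hm
  have hsub : ∀ {x : ℝ}, x ∈ Set.Ioc (0 : ℝ) (1 / ((m : ℝ) + 1)) →
      x ∈ Set.Icc (0 : ℝ) (1 / ((m : ℝ) + 1)) := fun h => ⟨h.1.le, h.2⟩
  refine ⟨?_, fun x hx hxθ => ?_⟩
  · obtain ⟨x, hx, hxθ⟩ := intermediate_value_Icc' (by positivity)
      (continuous_simplexTput m).continuousOn (a := 0) (b := 1 / ((m : ℝ) + 1))
      ⟨(simplexTput_one_div hm).trans_le hθ1, hθ2.le.trans_eq (simplexTput_zero m).symm⟩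
    have hx0 : 0 < x := by
      refine lt_of_le_of_ne hx.1 ?_
      rintro rfl
      rw [simplexTput_zero] at hxθ
      exact hθ2.ne' hxθ
    refine ⟨x, ⟨⟨hx0, hx.2⟩, hxθ⟩, fun y hy => ?_⟩
    exact hanti.injOn (hsub hy.1) hx (hy.2.trans hxθ.symm)
  obtain ⟨h1, hy0, hy1, hxy⟩ := simplex_bounds hm hx
  have hb := odds_pos hx.1 h1
  have hB := odds_pos hy0 hy1
  set P := pstar n (m + 1) x with hP
  have hPi : ∀ i, P i = if (i : ℕ) = 0 then x else if (i : ℕ) < m + 1 then (1 - x) / (m : ℝ)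
      else 0 := by
    intro i
    rw [hP, pstar, hcast, add_sub_cancel_right]
  have hP01 : ∀ i, P i ∈ Set.Ico (0 : ℝ) 1 := by
    intro i
    rw [hPi]
    split_ifs
    exacts [⟨hx.1.le, h1⟩, ⟨hy0.le, hy1⟩, ⟨le_rfl, one_pos⟩]
  set A : Finset (Fin n) := {i | (i : ℕ) < m + 1} with hA
  have hcard : A.card - 1 = m := by
    rw [hA, Fin.card_filter_val_lt]
    omega
  have i0 : (⟨0, by omega⟩ : Fin n) ∈ A := by simp [hA]
  have v0 : odds (P ⟨0, by omega⟩) = odds x := by rw [hPi]; simp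
  have vA : ∀ j ∈ A, j ≠ ⟨0, by omega⟩ → odds (P j) = odds ((1 - x) / m) := by
    intro j hj hj0
    have h2 : (j : ℕ) ≠ 0 := fun h => hj0 (Fin.ext h)
    have h3 : (j : ℕ) < m + 1 := by simpa [hA] using hj
    rw [hPi, if_neg h2, if_pos h3]
  have vC : ∀ j ∉ A, odds (P j) = 0 := by
    intro j hj
    have h3 : ¬ (j : ℕ) < m + 1 := by simpa [hA] using hj
    rw [hPi, if_neg (by omega), if_neg h3, odds, zero_div]
  have s1 := sum_of_two_values i0 v0 vA vC (g := fun x : ℝ => x) rfl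
  have s2 := sum_of_two_values i0 v0 vA vC (g := fun x : ℝ => x ^ 2) (by norm_num)
  have s3 := prod_of_two_values i0 v0 vA vC (g := fun x : ℝ => 1 + x) (by norm_num)
  simp only [hcard, nsmul_eq_mul] at s1 s2 s3
  refine ⟨?_, fun p hp hpθ => ?_, fun hθ => ?_⟩
  · rw [tput_eq_odds fun i => (hP01 i).2, s1, s3, ← simplexTput_eq_odds hm hx, hxθ]
  · rw [jain_rate_eq_odds hp, jain_rate_eq_odds hP01]
    have hT := (tput_eq_odds fun i => (hp i).2).symm.trans (hpθ.trans hxθ.symm)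
    have hle := simplex_concentration_le hm hx (fun i => odds_nonneg (hp i).1 (hp i).2) hT
    refine jain_le_jain ?_ (by rw [s2]; positivity) (by rw [s1, s2]; exact hle)
    have hTpos : 0 < simplexTput m x := by
      rw [simplexTput_eq_odds hm hx]
      positivity
    refine lt_of_le_of_ne (Finset.sum_nonneg fun i _ => sq_nonneg _) fun h => ?_
    have hz := (Finset.sum_eq_zero_iff_of_nonneg fun i _ => sq_nonneg (odds (p i))).1 h.symm
    rw [← hT, Finset.sum_eq_zero fun i hi => pow_eq_zero_iff two_ne_zero |>.1 (hz i hi),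
      zero_div] at hTpos
    exact lt_irrefl _ hTpos
  · have hxe : x = 1 / ((m : ℝ) + 1) :=
      hanti.injOn (hsub hx) ⟨by positivity, le_rfl⟩
        (hxθ.trans (hθ.trans (simplexTput_one_div hm).symm))
    refine ⟨hxe, ?_⟩
    have hye : (1 - x) / (m : ℝ) = x := by
      rw [hxe]
      field_simp
      ring
    rw [jain_rate_eq_odds hP01, jain, s1, s2, hye]
    have hn0 : (n : ℝ) ≠ 0 := by positivity
    field_simp
    ring
end

section
/- (Theorem 3, items 2 and 3: monotonicity of the Jain tradeoff curve.) Let n ≥ 2 and define F_J*(θ; n) = sup{ F_J(x(p)) : p ∈ [0,1)^n, T(x(p)) = θ }. Then: (a) for all θ, θ' with θ_n ≤ θ < θ' < 1, F_J*(θ'; n) < F_J*(θ; n) (the tradeoff curve is strictly decreasing in θ on [θ_n, 1)); and (b) for every θ ∈ [θ_n, 1), F_J*(θ; n+1) < F_J*(θ; n) (for fixed θ the tradeoff curve is decreasing in the number of users). -/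
open scoped BigOperators

/-- The optimized Jain fairness under the throughput equality constraint. -/
noncomputable def FJstar (n : ℕ) (θ : ℝ) : ℝ :=
  sSup {v : ℝ | ∃ p : Fin n → ℝ, (∀ i, p i ∈ Set.Ico (0:ℝ) 1) ∧
    tput p = θ ∧ v = jain (fun i => rate p i)}

lemma jain_const_mul {n : ℕ} (x : Fin n → ℝ) {c : ℝ} (hc : c ≠ 0) :
    jain (fun i => c * x i) = jain x := by
  unfold jain
  simp only [mul_pow, ← Finset.mul_sum]
  rw [mul_left_comm, mul_div_mul_left _ _ (pow_ne_zero 2 hc)]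

lemma jain_of_eq_zero_of_ne {n : ℕ} {x : Fin n → ℝ} {i : Fin n} (hi : x i ≠ 0)
    (h : ∀ j, j ≠ i → x j = 0) : jain x = 1 / n := by
  have h1 : ∑ j, x j = x i := Finset.sum_eq_single i (fun j _ hj => h j hj) (by simp)
  have h2 : ∑ j, x j ^ 2 = x i ^ 2 :=
    Finset.sum_eq_single i (fun j _ hj => by simp [h j hj]) (by simp)
  unfold jain
  rw [h1, h2, mul_comm, ← div_div, div_self (pow_ne_zero 2 hi)]

lemma rate_eq_zero_of_eq_one {n : ℕ} {p : Fin n → ℝ} {i j : Fin n} (hp : p i = 1) (hj : j ≠ i) :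
    rate p j = 0 := by
  unfold rate
  rw [Finset.prod_eq_zero (i := i) (by simp [hj.symm]) (by simp [hp]), mul_zero]

lemma rate_single {n : ℕ} (i : Fin n) (θ : ℝ) : rate (Pi.single i θ) = Pi.single i θ := by
  funext j
  unfold rate
  rcases eq_or_ne j i with rfl | hj
  · rw [Finset.prod_eq_one, mul_one]
    intro k hk
    simp [Pi.single_eq_of_ne (Finset.ne_of_mem_erase hk)]
  · simp [Pi.single_eq_of_ne hj]

/-- The rate vector in terms of the odds `z i = p i / (1 - p i)`. -/
lemma rate_of_odds {n : ℕ} {z : Fin n → ℝ} (hz : ∀ i, 0 ≤ z i) (i : Fin n) :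
    rate (fun j => z j / (1 + z j)) i = (∏ j, (1 + z j))⁻¹ * z i := by
  have h (j : Fin n) : 1 - z j / (1 + z j) = (1 + z j)⁻¹ := by
    have : 1 + z j ≠ 0 := by linarith [hz j]
    field_simp
    ring
  unfold rate
  simp only [h]
  rw [← Finset.prod_inv_distrib, ← Finset.mul_prod_erase Finset.univ _ (Finset.mem_univ i)]
  ring

/-- The maximum of Jain's fairness under the throughput constraint is attained: on the closed cube
by compactness, and a maximizer with some `p i = 1` serves a single user, which is also possible
with `p i < 1`. -/
lemma exists_isGreatest_jain {n : ℕ} (hn : n ≠ 0) {θ : ℝ} (h0 : 0 < θ) (h1 : θ < 1) :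
    ∃ v, IsGreatest {v : ℝ | ∃ p : Fin n → ℝ, (∀ i, p i ∈ Set.Ico (0:ℝ) 1) ∧
      tput p = θ ∧ v = jain (fun i => rate p i)} v := by
  have hrate (i : Fin n) : Continuous fun p : Fin n → ℝ => rate p i := by
    unfold rate
    fun_prop
  have htput : Continuous (tput : (Fin n → ℝ) → ℝ) := by
    unfold tput
    fun_prop
  have hsingle (i : Fin n) : (∀ j, (Pi.single i θ : Fin n → ℝ) j ∈ Set.Ico (0:ℝ) 1) ∧
      tput (Pi.single i θ : Fin n → ℝ) = θ ∧
      jain (fun j => rate (Pi.single i θ : Fin n → ℝ) j) = 1 / n := by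
    refine ⟨fun j => ?_, ?_, ?_⟩
    · rcases eq_or_ne j i with rfl | hj
      · simpa using ⟨h0.le, h1⟩
      · simp [Pi.single_eq_of_ne hj]
    · unfold tput
      simp [rate_single]
    · rw [rate_single]
      exact jain_of_eq_zero_of_ne (i := i) (by simpa using h0.ne')
        (fun j hj => by simp [Pi.single_eq_of_ne hj])
  let i₀ : Fin n := ⟨0, Nat.pos_of_ne_zero hn⟩
  have hcompact : IsCompact (Set.Icc (0 : Fin n → ℝ) 1 ∩ {p | tput p = θ}) :=
    isCompact_Icc.inter_right (isClosed_eq htput continuous_const)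
  obtain ⟨p, ⟨⟨hp0, hp1⟩, hpT⟩, hmax⟩ := hcompact.exists_isMaxOn
    (f := fun p => jain fun i => rate p i)
    ⟨Pi.single i₀ θ, ⟨fun j => ((hsingle i₀).1 j).1, fun j => ((hsingle i₀).1 j).2.le⟩,
      (hsingle i₀).2.1⟩ (by
    unfold jain
    refine ContinuousOn.div (by fun_prop) (by fun_prop) ?_
    rintro p ⟨-, hpT⟩
    refine mul_ne_zero (by exact_mod_cast hn) fun hzero => h0.ne' ?_
    rw [Finset.sum_eq_zero_iff_of_nonneg fun _ _ => sq_nonneg _] at hzero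
    rw [← show tput p = θ from hpT]
    exact Finset.sum_eq_zero fun i hi => pow_eq_zero_iff two_ne_zero |>.1 (hzero i hi))
  have hub : ∀ q : Fin n → ℝ, (∀ i, q i ∈ Set.Ico (0:ℝ) 1) → tput q = θ →
      jain (fun i => rate q i) ≤ jain (fun i => rate p i) := fun q hq hqT =>
    hmax ⟨⟨fun j => (hq j).1, fun j => (hq j).2.le⟩, hqT⟩
  refine ⟨jain fun i => rate p i, ?_, by rintro _ ⟨q, hq, hqT, rfl⟩; exact hub q hq hqT⟩
  by_cases hone : ∃ i, p i = 1
  · obtain ⟨i, hi⟩ := hone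
    refine ⟨Pi.single i θ, (hsingle i).1, (hsingle i).2.1, ?_⟩
    rw [(hsingle i).2.2]
    have hTi : rate p i = θ := by
      rw [← show tput p = θ from hpT]
      exact (Finset.sum_eq_single i (fun j _ hj => rate_eq_zero_of_eq_one hi hj) (by simp)).symm
    exact jain_of_eq_zero_of_ne (i := i) (by simpa [hTi] using h0.ne')
      fun j hj => rate_eq_zero_of_eq_one hi hj
  · push Not at hone
    exact ⟨p, fun i => ⟨hp0 i, lt_of_le_of_ne (hp1 i) (hone i)⟩, hpT, rfl⟩

lemma jain_rate_of_odds {n : ℕ} {z : Fin n → ℝ} (hz : ∀ i, 0 ≤ z i) :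
    jain (fun i => rate (fun j => z j / (1 + z j)) i) = jain z := by
  simp only [rate_of_odds hz]
  exact jain_const_mul z (inv_ne_zero (Finset.prod_ne_zero_iff.2 fun j _ => by linarith [hz j]))

lemma tput_of_odds {n : ℕ} {z : Fin n → ℝ} (hz : ∀ i, 0 ≤ z i) :
    tput (fun j => z j / (1 + z j)) = (∑ i, z i) / ∏ i, (1 + z i) := by
  unfold tput
  simp only [rate_of_odds hz]
  rw [← Finset.mul_sum, div_eq_inv_mul]

lemma exists_odds_jain_eq_FJstar {n : ℕ} (hn : n ≠ 0) {θ : ℝ} (h0 : 0 < θ) (h1 : θ < 1) :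
    ∃ z : Fin n → ℝ, (∀ i, 0 ≤ z i) ∧ (∑ i, z i) / ∏ i, (1 + z i) = θ ∧ jain z = FJstar n θ := by
  obtain ⟨v, hv⟩ := exists_isGreatest_jain hn h0 h1
  obtain ⟨p, hp, hpT, hpv⟩ := hv.1
  have hz (i : Fin n) : 0 ≤ p i / (1 - p i) :=
    div_nonneg (hp i).1 (by linarith [(hp i).2])
  have hpz : (fun i => (p i / (1 - p i)) / (1 + p i / (1 - p i))) = p := by
    funext i
    have : 1 - p i ≠ 0 := by linarith [(hp i).2]
    field_simp
    ring
  refine ⟨fun i => p i / (1 - p i), hz, ?_, ?_⟩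
  · rw [← tput_of_odds hz, hpz, hpT]
  · rw [← jain_rate_of_odds hz, hpz, ← hpv]
    exact hv.csSup_eq.symm

/-- Scaling the odds down lowers the throughput continuously to `0` and keeps Jain's fairness. -/
lemma jain_le_FJstar {n : ℕ} (hn : n ≠ 0) {θ : ℝ} (h0 : 0 < θ) (h1 : θ < 1) {z : Fin n → ℝ}
    (hz : ∀ i, 0 ≤ z i) (hT : θ ≤ (∑ i, z i) / ∏ i, (1 + z i)) : jain z ≤ FJstar n θ := by
  obtain ⟨v, hv⟩ := exists_isGreatest_jain hn h0 h1
  have hcont : ContinuousOn (fun c : ℝ => (∑ i, c * z i) / ∏ i, (1 + c * z i)) (Set.Icc 0 1) := by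
    refine ContinuousOn.div (by fun_prop) (by fun_prop) fun c hc => ?_
    exact Finset.prod_ne_zero_iff.2 fun j _ => by linarith [mul_nonneg hc.1 (hz j)]
  obtain ⟨c, hc, hcT⟩ := intermediate_value_Icc zero_le_one hcont
    (show θ ∈ Set.Icc _ _ from ⟨by simpa using h0.le, by simpa using hT⟩)
  have hc0 : c ≠ 0 := by
    rintro rfl
    simp at hcT
    exact h0.ne hcT
  have hcz (i : Fin n) : 0 ≤ c * z i := mul_nonneg hc.1 (hz i)
  have hle : jain (fun i => c * z i) ≤ v := hv.2
    ⟨fun i => c * z i / (1 + c * z i), fun i => ⟨div_nonneg (hcz i) (by linarith [hcz i]),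
      (div_lt_one (by linarith [hcz i])).2 (by linarith)⟩,
      (tput_of_odds hcz).trans hcT, (jain_rate_of_odds hcz).symm⟩
  rw [jain_const_mul z hc0] at hle
  exact hle.trans_eq hv.csSup_eq.symm

lemma crit_pos {n : ℕ} (hn : 2 ≤ n) : 0 < crit n := by
  have : (2 : ℝ) ≤ n := by exact_mod_cast hn
  exact pow_pos (by rw [sub_pos, div_lt_one] <;> linarith) _

lemma crit_succ_lt {n : ℕ} (hn : 2 ≤ n) : crit (n + 1) < crit n := by
  obtain ⟨m, rfl⟩ : ∃ m, n = m + 1 := ⟨n - 1, by omega⟩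
  have hm : (1 : ℝ) ≤ m := by exact_mod_cast (by omega : 1 ≤ m)
  unfold crit
  push_cast
  have e1 : (1 : ℝ) - 1 / (m + 1 + 1) = (m + 1) / (m + 2) := by field_simp; ring
  have e2 : (1 : ℝ) - 1 / (m + 1) = m / (m + 1) := by field_simp; ring
  rw [e1, e2]
  have hb := one_add_mul_le_pow (a := -(1 / ((m : ℝ) + 1) ^ 2)) (by
    have : 1 / ((m : ℝ) + 1) ^ 2 ≤ 1 := by
      rw [div_le_one (by positivity)]
      nlinarith
    linarith) m
  have e3 : (m : ℝ) / (m + 1) = (m + 1) / (m + 2) * ((m + 2) / (m + 1) * (m / (m + 1))) := by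
    field_simp
  have e4 : ((m : ℝ) + 2) / (m + 1) * (m / (m + 1)) = 1 + -(1 / ((m : ℝ) + 1) ^ 2) := by
    field_simp
    ring
  rw [e3, e4, mul_pow, pow_succ]
  refine mul_lt_mul_of_pos_left (lt_of_lt_of_le ?_ hb) (by positivity)
  have e5 : 1 + (m : ℝ) * -(1 / ((m : ℝ) + 1) ^ 2) - (m + 1) / (m + 2)
      = 1 / ((m + 1) ^ 2 * (m + 2)) := by
    field_simp
    ring
  have : (0 : ℝ) < 1 / ((m + 1) ^ 2 * (m + 2)) := by positivity
  linarith

/-- Equal odds give throughput at most the critical one. -/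
lemma sum_div_prod_le_crit_of_const {n : ℕ} (hn : 2 ≤ n) {z : Fin n → ℝ} {c : ℝ} (hc : 0 ≤ c)
    (hz : ∀ i, z i = c) : (∑ i, z i) / ∏ i, (1 + z i) ≤ crit n := by
  obtain ⟨m, rfl⟩ : ∃ m, n = m + 1 := ⟨n - 1, by omega⟩
  have hm : (1 : ℝ) ≤ m := by exact_mod_cast (by omega : 1 ≤ m)
  simp only [hz]
  rw [Finset.sum_const, Finset.prod_const, Finset.card_univ, Fintype.card_fin, nsmul_eq_mul,
    div_le_iff₀ (by positivity)]
  unfold crit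
  simp only [Nat.add_sub_cancel]
  have e2 : (1 : ℝ) - 1 / ((m + 1 : ℕ) : ℝ) = m / (m + 1) := by push_cast; field_simp; ring
  rw [e2]
  have hb := one_add_mul_le_pow (a := (m * (1 + c)) / (m + 1) - 1) (by
    have : 0 ≤ ((m : ℝ) * (1 + c)) / (m + 1) := by positivity
    linarith) (m + 1)
  have e3 : (1 : ℝ) + ((m + 1 : ℕ) : ℝ) * ((m * (1 + c)) / (m + 1) - 1) = m * c := by
    push_cast
    field_simp
    ring
  rw [e3, add_sub_cancel] at hb
  have e4 : ((m : ℝ) * (1 + c) / (m + 1)) ^ (m + 1)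
      = m / (m + 1) * ((m / (m + 1)) ^ m * (1 + c) ^ (m + 1)) := by
    rw [div_pow, mul_pow, div_pow]
    field_simp
    ring
  rw [e4, div_mul_eq_mul_div, le_div_iff₀ (by positivity)] at hb
  push_cast
  nlinarith

lemma sum_sub_sq {n : ℕ} (z : Fin n → ℝ) (c : ℝ) :
    ∑ i, (z i - c) ^ 2 = ∑ i, z i ^ 2 - 2 * c * ∑ i, z i + n * c ^ 2 := by
  simp only [sub_sq, Finset.sum_add_distrib, Finset.sum_sub_distrib, Finset.sum_const,
    Finset.card_univ, Fintype.card_fin, nsmul_eq_mul, ← Finset.sum_mul, ← Finset.mul_sum]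
  ring

lemma sum_sub_sq_pos {n : ℕ} {z : Fin n → ℝ} {c : ℝ} (h : ¬ ∀ i, z i = c) :
    0 < ∑ i, (z i - c) ^ 2 := by
  push Not at h
  obtain ⟨i, hi⟩ := h
  exact Finset.sum_pos' (fun _ _ => sq_nonneg _)
    ⟨i, Finset.mem_univ i, by have := sub_ne_zero.2 hi; positivity⟩

lemma sum_sq_pos_of_sum_pos {n : ℕ} {z : Fin n → ℝ} (hS : 0 < ∑ i, z i) :
    0 < ∑ i, z i ^ 2 := by
  have h : ¬ ∀ i, z i = 0 := fun h => hS.ne' (Finset.sum_eq_zero fun i _ => h i)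
  simpa using sum_sub_sq_pos h

lemma sum_pos_of_div_prod_pos {n : ℕ} {z : Fin n → ℝ} (hz : ∀ i, 0 ≤ z i)
    (h : 0 < (∑ i, z i) / ∏ i, (1 + z i)) : 0 < ∑ i, z i :=
  (div_pos_iff_of_pos_right (Finset.prod_pos fun i _ => by linarith [hz i])).1 h

/-- Moving unequal odds slightly towards their mean increases Jain's fairness, and lowers the
throughput by arbitrarily little. -/
lemma exists_fairer_odds {n : ℕ} (hn : n ≠ 0) {θ : ℝ} (h0 : 0 < θ) {z : Fin n → ℝ}
    (hz : ∀ i, 0 ≤ z i) (hne : ¬ ∀ i, z i = (∑ j, z j) / n)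
    (hT : θ < (∑ i, z i) / ∏ i, (1 + z i)) :
    ∃ y : Fin n → ℝ, (∀ i, 0 ≤ y i) ∧ θ ≤ (∑ i, y i) / ∏ i, (1 + y i) ∧ jain z < jain y := by
  have hn' : (0 : ℝ) < n := by exact_mod_cast Nat.pos_of_ne_zero hn
  have hS := sum_pos_of_div_prod_pos hz (h0.trans hT)
  set a := (∑ j, z j) / n with ha
  have hSa : ∑ j, z j = n * a := by rw [ha]; field_simp
  have ha0 : 0 < a := div_pos hS hn'
  have hsum (e : ℝ) : ∑ i, (z i + e * (a - z i)) = ∑ i, z i := by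
    rw [Finset.sum_add_distrib, ← Finset.mul_sum, Finset.sum_sub_distrib, hSa]
    simp
  have hcont : ContinuousAt
      (fun e : ℝ => (∑ i, (z i + e * (a - z i))) / ∏ i, (1 + (z i + e * (a - z i)))) 0 := by
    refine ContinuousAt.div (by fun_prop) (by fun_prop) ?_
    exact Finset.prod_ne_zero_iff.2 fun j _ => by simpa using by linarith [hz j]
  have hev := hcont.eventually (lt_mem_nhds (a := θ) (by simpa using hT))
  obtain ⟨e, he, he0, he1⟩ := ((hev.filter_mono nhdsWithin_le_nhds).and
    (Ioo_mem_nhdsGT (zero_lt_one (α := ℝ)))).exists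
  refine ⟨fun i => z i + e * (a - z i), fun i => ?_, he.le, ?_⟩
  · nlinarith [mul_nonneg (sub_nonneg.2 he1.le) (hz i), mul_pos he0 ha0]
  · have hvar := sum_sub_sq_pos hne
    have hy : 0 < ∑ i, (z i + e * (a - z i)) ^ 2 :=
      sum_sq_pos_of_sum_pos (z := fun i => z i + e * (a - z i)) (by simpa only [hsum] using hS)
    unfold jain
    rw [hsum]
    refine div_lt_div_of_pos_left (by positivity) (by positivity) ?_
    refine mul_lt_mul_of_pos_left ?_ hn'
    have h1 := sum_sub_sq z a
    have h2 := sum_sub_sq (fun i => z i + e * (a - z i)) a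
    have h3 : ∑ i, (z i + e * (a - z i) - a) ^ 2 = (1 - e) ^ 2 * ∑ i, (z i - a) ^ 2 := by
      rw [Finset.mul_sum]
      exact Finset.sum_congr rfl fun i _ => by ring
    rw [hsum] at h2
    have h4 : (1 - e) ^ 2 * ∑ i, (z i - a) ^ 2 < 1 * ∑ i, (z i - a) ^ 2 :=
      mul_lt_mul_of_pos_right (by nlinarith) hvar
    linarith

/-- Removing a user of least odds and spreading these evenly over the other users increases
Jain's fairness strictly, unless all odds are equal, and does not lower the throughput. -/
lemma exists_fairer_odds_of_succ {n : ℕ} (hn : n ≠ 0) {z : Fin (n + 1) → ℝ}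
    (hz : ∀ i, 0 ≤ z i) (hS : 0 < ∑ i, z i) (hne : ∀ c, ¬ ∀ i, z i = c) :
    ∃ y : Fin n → ℝ, (∀ i, 0 ≤ y i) ∧
      (∑ i, z i) / ∏ i, (1 + z i) ≤ (∑ i, y i) / ∏ i, (1 + y i) ∧ jain z < jain y := by
  have hn' : (0 : ℝ) < n := by exact_mod_cast Nat.pos_of_ne_zero hn
  obtain ⟨k, hk⟩ := Finite.exists_min z
  set m := z k with hm
  have hm0 : 0 ≤ m := hz k
  have hy0 (i : Fin n) : 0 ≤ z (k.succAbove i) + m / n := add_nonneg (hz _) (by positivity)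
  have hsum : ∑ i : Fin n, (z (k.succAbove i) + m / n) = ∑ i, z i := by
    rw [Fin.sum_univ_succAbove z k, Finset.sum_add_distrib]
    simp only [Finset.sum_const, Finset.card_univ, Fintype.card_fin, nsmul_eq_mul]
    field_simp
    ring
  refine ⟨fun i => z (k.succAbove i) + m / n, hy0, ?_, ?_⟩
  · rw [hsum]
    refine div_le_div_of_nonneg_left hS.le
      (Finset.prod_pos fun i _ => by linarith [hy0 i]) ?_
    rw [Fin.prod_univ_succAbove _ k]
    have hfac (i : Fin n) : 1 + (z (k.succAbove i) + m / n)
        ≤ (1 + z (k.succAbove i)) * Real.exp (m / (1 + m) / n) := by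
      have hi : m ≤ z (k.succAbove i) := hk _
      calc 1 + (z (k.succAbove i) + m / n)
          = 1 + z (k.succAbove i) + (1 + m) * (m / (1 + m) / n) := by field_simp; ring
        _ ≤ 1 + z (k.succAbove i) + (1 + z (k.succAbove i)) * (m / (1 + m) / n) := by gcongr
        _ = (1 + z (k.succAbove i)) * (m / (1 + m) / n + 1) := by ring
        _ ≤ _ := mul_le_mul_of_nonneg_left (Real.add_one_le_exp _) (by linarith)
    have hexp : Real.exp (m / (1 + m)) ≤ 1 + m := by
      rw [← Real.le_log_iff_exp_le (by linarith)]
      have h := Real.one_sub_inv_le_log_of_pos (show 0 < 1 + m by linarith)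
      have e : m / (1 + m) = 1 - (1 + m)⁻¹ := by field_simp; ring
      rwa [e]
    calc ∏ i : Fin n, (1 + (z (k.succAbove i) + m / n))
        ≤ ∏ i : Fin n, ((1 + z (k.succAbove i)) * Real.exp (m / (1 + m) / n)) :=
          Finset.prod_le_prod (fun i _ => by linarith [hy0 i]) fun i _ => hfac i
      _ = Real.exp (m / (1 + m)) * ∏ i : Fin n, (1 + z (k.succAbove i)) := by
          rw [Finset.prod_mul_distrib, Finset.prod_const, Finset.card_univ, Fintype.card_fin,
            ← Real.exp_nat_mul, mul_div_cancel₀ _ hn'.ne', mul_comm]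
      _ ≤ _ := mul_le_mul_of_nonneg_right hexp
          (Finset.prod_nonneg fun i _ => by linarith [hz (k.succAbove i)])
  · have hvar := sum_sub_sq_pos (hne m)
    have hy : 0 < ∑ i : Fin n, (z (k.succAbove i) + m / n) ^ 2 :=
      sum_sq_pos_of_sum_pos (z := fun i : Fin n => z (k.succAbove i) + m / n)
        (by simpa only [hsum] using hS)
    unfold jain
    rw [hsum]
    refine div_lt_div_of_pos_left (by positivity) (by positivity) ?_
    have h1 := sum_sub_sq z m
    have h2 := sum_sub_sq (fun i : Fin n => z (k.succAbove i) + m / n) (m / n)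
    simp only [add_sub_cancel_right, hsum] at h2
    have h3 := Fin.sum_univ_succAbove (fun i => z i ^ 2) k
    have h4 : (n : ℝ) * ∑ i : Fin n, (z (k.succAbove i) + m / n) ^ 2
        = n * ∑ i : Fin n, z (k.succAbove i) ^ 2 + 2 * m * ∑ i, z i - m ^ 2 := by
      rw [h2]
      field_simp
      ring
    rw [h4]
    push_cast at h1 ⊢
    rw [h3] at h1 ⊢
    nlinarith

theorem jain_tradeoff_monotonicity (n : ℕ) (hn : 2 ≤ n) :
    (∀ θ θ' : ℝ, crit n ≤ θ → θ < θ' → θ' < 1 → FJstar n θ' < FJstar n θ) ∧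
    (∀ θ : ℝ, crit n ≤ θ → θ < 1 → FJstar (n + 1) θ < FJstar n θ) := by
  have hn0 : n ≠ 0 := by omega
  refine ⟨fun θ θ' hθ hlt hθ' => ?_, fun θ hθ hθ1 => ?_⟩
  · have h0 : 0 < θ := (crit_pos hn).trans_le hθ
    obtain ⟨z, hz, hzT, hzF⟩ := exists_odds_jain_eq_FJstar hn0 (h0.trans hlt) hθ'
    have hne : ¬ ∀ i, z i = (∑ j, z j) / n := fun h => by
      have := sum_div_prod_le_crit_of_const hn
        (div_nonneg (Finset.sum_nonneg fun i _ => hz i) n.cast_nonneg) h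
      linarith
    obtain ⟨y, hy, hyT, hzy⟩ := exists_fairer_odds hn0 h0 hz hne (hzT ▸ hlt)
    exact hzF ▸ hzy.trans_le (jain_le_FJstar hn0 h0 (hlt.trans hθ') hy hyT)
  · have h0 : 0 < θ := (crit_pos hn).trans_le hθ
    obtain ⟨z, hz, hzT, hzF⟩ := exists_odds_jain_eq_FJstar n.succ_ne_zero h0 hθ1
    have hne : ∀ c, ¬ ∀ i, z i = c := fun c h => by
      have := sum_div_prod_le_crit_of_const (by omega) (h 0 ▸ hz 0) h
      linarith [crit_succ_lt hn]
    obtain ⟨y, hy, hyT, hzy⟩ := exists_fairer_odds_of_succ hn0 hz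
      (sum_pos_of_div_prod_pos hz (hzT ▸ h0)) hne
    exact hzF ▸ hzy.trans_le (jain_le_FJstar hn0 h0 hθ1 hy (hzT ▸ hyT))
end
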